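/- Let w be a nonnegative even integer and p ∈ V_w^+. Then p(X+Y,Y) − p(X−Y,Y) − p(X+Y,X) + p(X−Y,X) = 0 if and only if the polynomial q(X,Y) := p(Y,X) satisfies q(X,Y) + q(−X−Y,2X+Y) − q(X+Y,Y) − q(X,2X+Y) = 0 (that is, if and only if p(Y,X) is an even period polynomial for the congruence subgroup Γ₀(2) of SL₂(ℤ)). -/

import Mathlib

open MvPolynomial

/-- Substitution: `sub2 a b p` is `p(a, b)` for a bivariate polynomial `p(X,Y)`. -/
noncomputable def sub2 (a b p : MvPolynomial (Fin 2) ℚ) : MvPolynomial (Fin 2) ℚ :=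
  aeval ![a, b] p

/-- `memV w ε p` : `p ∈ V_w^ε`, i.e. `p` is homogeneous of degree `w` and
`p(-X,Y) = ε p(X,Y)`. -/
def memV (w : ℕ) (ε : ℤ) (p : MvPolynomial (Fin 2) ℚ) : Prop :=
  p.IsHomogeneous w ∧ sub2 (-X 0) (X 1) p = (ε : ℚ) • p

/-- `memW w ε p` : `p ∈ W_w^ε`, the space of period polynomials: `p ∈ V_w^ε` with
`p(X,Y) + p(-Y,X) = 0` and `p(X,Y) + p(X-Y,X) + p(-Y,X-Y) = 0`. -/
def memW (w : ℕ) (ε : ℤ) (p : MvPolynomial (Fin 2) ℚ) : Prop :=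
  memV w ε p ∧
  p + sub2 (-X 1) (X 0) p = 0 ∧
  p + sub2 (X 0 - X 1) (X 0) p + sub2 (-X 1) (X 0 - X 1) p = 0

theorem sub2_sub2 (a b c d p : MvPolynomial (Fin 2) ℚ) :
    sub2 a b (sub2 c d p) = sub2 (sub2 a b c) (sub2 a b d) p := by
  unfold sub2
  rw [← AlgHom.comp_apply]
  congr 1
  ext i
  fin_cases i <;> simp

theorem sub2_neg_neg {w : ℕ} (hw : Even w) {p : MvPolynomial (Fin 2) ℚ}
    (hp : p.IsHomogeneous w) (a b : MvPolynomial (Fin 2) ℚ) :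
    sub2 (-a) (-b) p = sub2 a b p := by
  simp only [sub2, aeval_def, eval₂_eq', Fin.prod_univ_two]
  refine Finset.sum_congr rfl fun d hd => ?_
  have hdeg : d 0 + d 1 = w := by
    simpa [Finsupp.weight_apply, Finsupp.sum_fintype] using hp (mem_support_iff.mp hd)
  have hsign : (-1 : MvPolynomial (Fin 2) ℚ) ^ d 0 * (-1) ^ d 1 = 1 := by
    rw [← pow_add, hdeg, hw.neg_one_pow]
  simp only [Matrix.cons_val_zero, Matrix.cons_val_one]
  rw [neg_pow a, neg_pow b]
  linear_combination (algebraMap ℚ (MvPolynomial (Fin 2) ℚ) (coeff d p) * a ^ d 0 * b ^ d 1) * hsign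

theorem sub2_neg_left {w : ℕ} {p : MvPolynomial (Fin 2) ℚ} (hp : memV w 1 p)
    (a b : MvPolynomial (Fin 2) ℚ) : sub2 (-a) b p = sub2 a b p := by
  have h := congrArg (sub2 a b) hp.2
  rw [sub2_sub2] at h
  simpa [sub2] using h

theorem sub2_neg_right {w : ℕ} (hw : Even w) {p : MvPolynomial (Fin 2) ℚ} (hp : memV w 1 p)
    (a b : MvPolynomial (Fin 2) ℚ) : sub2 a (-b) p = sub2 a b p := by
  rw [← sub2_neg_left hp, sub2_neg_neg hw hp.1]

theorem stmt10 (w : ℕ) (hw : Even w)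
    (p : MvPolynomial (Fin 2) ℚ) (hp : memV w 1 p)
    (q : MvPolynomial (Fin 2) ℚ) (hq : q = sub2 (X 1) (X 0) p) :
    (sub2 (X 0 + X 1) (X 1) p - sub2 (X 0 - X 1) (X 1) p
        - sub2 (X 0 + X 1) (X 0) p + sub2 (X 0 - X 1) (X 0) p = 0)
      ↔ (q + sub2 (-X 0 - X 1) (2 * X 0 + X 1) q - sub2 (X 0 + X 1) (X 1) q
          - sub2 (X 0) (2 * X 0 + X 1) q = 0) := by
  have hsub : ∀ a b c d : MvPolynomial (Fin 2) ℚ,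
      sub2 a b (sub2 c d p) = sub2 (sub2 a b c) (sub2 a b d) p := fun a b c d => sub2_sub2 a b c d p
  have hX0 : ∀ a b : MvPolynomial (Fin 2) ℚ, sub2 a b (X 0) = a := fun a b => by simp [sub2]
  have hX1 : ∀ a b : MvPolynomial (Fin 2) ℚ, sub2 a b (X 1) = b := fun a b => by simp [sub2]
  have hadd : ∀ a b f g : MvPolynomial (Fin 2) ℚ,
      sub2 a b (f + g) = sub2 a b f + sub2 a b g := fun a b f g => map_add _ f g
  have hsubt : ∀ a b f g : MvPolynomial (Fin 2) ℚ,
      sub2 a b (f - g) = sub2 a b f - sub2 a b g := fun a b f g => map_sub _ f g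
  have hmul : ∀ a b f : MvPolynomial (Fin 2) ℚ,
      sub2 a b (2 * f) = 2 * sub2 a b f := fun a b f => by
    rw [two_mul, two_mul, hadd]
  have hzero : ∀ a b : MvPolynomial (Fin 2) ℚ, sub2 a b 0 = 0 := fun a b => map_zero _
  have hneg := sub2_neg_right hw hp
  have hdiff : (-X 0 - X 1 : MvPolynomial (Fin 2) ℚ) = -(X 0 + X 1) := by ring
  subst hq
  simp only [hsub, hX0, hX1, hdiff, hneg]
  constructor
  · intro h
    have h' := congrArg (sub2 (X 0 + X 1) (X 0)) h
    simp only [hadd, hsubt, hsub, hX0, hX1, hzero] at h'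
    rw [show (X 0 + X 1 + X 0 : MvPolynomial (Fin 2) ℚ) = 2 * X 0 + X 1 by ring,
      add_sub_cancel_left] at h'
    linear_combination -h'
  · intro h
    have h' := congrArg (sub2 (X 1) (X 0 - X 1)) h
    simp only [hadd, hsubt, hmul, hsub, hX0, hX1, hzero] at h'
    rw [show (2 * X 1 + (X 0 - X 1) : MvPolynomial (Fin 2) ℚ) = X 0 + X 1 by ring,
      add_sub_cancel] at h'
    linear_combination -h'
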